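/- Let n ≥ 1, let q, λ, μ ∈ ℂ with q nonzero and not a root of unity, λ ≠ 0, and let α ∈ ℤ_{≥0}^n with (μ;q)_{|α|} ≠ 0. Then Σ_{γ ∈ ℤ_{≥0}^n, γ ≤ α} q^{φ(γ,α) − φ(α,γ)} Φ_q^{(n)}(γ|α;λ,μ) = 1. (Equivalently, for operators K_α satisfying K_0 = 1 and K_α K_β = q^{φ(α,β)} K_{α+β}, the assignment Z_α(ζ) = K_α satisfies the Zamolodchikov–Faddeev relation Z_α(μ)Z_β(λ) = Σ_{γ ≤ α} q^{φ(α−γ,β−γ)} Φ_q^{(n)}(γ|α;λ,μ) Z_γ(λ) Z_{α+β−γ}(μ).) -/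

import Mathlib

/-- The q-Pochhammer symbol `(z;q)_m = ∏_{j=0}^{m-1} (1 - z q^j)`. -/
noncomputable def qPoch (q z : ℂ) (m : ℕ) : ℂ := ∏ j ∈ Finset.range m, (1 - z * q ^ j)

/-- The q-binomial coefficient `binom(m,k)_q`. -/
noncomputable def qBinom (q : ℂ) (m k : ℕ) : ℂ :=
  if k ≤ m then qPoch q q m / (qPoch q q k * qPoch q q (m - k)) else 0

/-- `q` is not a root of unity. -/
def notRootOfUnity (q : ℂ) : Prop := ∀ m : ℕ, 0 < m → q ^ m ≠ 1

/-- `φ(β,γ) = Σ_{1 ≤ i < j ≤ k} β_i γ_j` for integer vectors. -/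
def phi {k : ℕ} (β γ : Fin k → ℤ) : ℤ :=
  ∑ i, ∑ j, if i < j then β i * γ j else 0

open Classical in
/-- The weight `Φ_q^{(n)}(γ|β;λ,μ)` of the stochastic R matrix of `U_q(A^{(1)}_n)`. -/
noncomputable def Phi (n : ℕ) (q lam mu : ℂ) (γ β : Fin n → ℕ) : ℂ :=
  if γ ≤ β then
    q ^ phi (fun i => (β i : ℤ) - (γ i : ℤ)) (fun i => (γ i : ℤ))
      * (mu / lam) ^ (∑ i, γ i)
      * qPoch q lam (∑ i, γ i) * qPoch q (mu / lam) ((∑ i, β i) - ∑ i, γ i)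
      * (∏ i, qBinom q (β i) (γ i)) / qPoch q mu (∑ i, β i)
  else 0


theorem qPoch_succ (q z : ℂ) (m : ℕ) : qPoch q z (m + 1) = qPoch q z m * (1 - z * q ^ m) :=
  Finset.prod_range_succ _ _

theorem qPoch_add (q z : ℂ) (m k : ℕ) :
    qPoch q z (m + k) = qPoch q z m * qPoch q (z * q ^ m) k := by
  simp only [qPoch, Finset.prod_range_add, pow_add, mul_assoc]

theorem qPoch_self_ne_zero {q : ℂ} (hq : notRootOfUnity q) (m : ℕ) : qPoch q q m ≠ 0 := by
  refine Finset.prod_ne_zero_iff.2 fun j _ h => hq (j + 1) j.succ_pos ?_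
  rw [pow_succ']
  exact (sub_eq_zero.1 h).symm

theorem qBinom_zero_right {q : ℂ} (hq : notRootOfUnity q) (m : ℕ) : qBinom q m 0 = 1 := by
  have h := qPoch_self_ne_zero hq m
  have h0 : qPoch q q 0 = 1 := Finset.prod_range_zero _
  simp [qBinom, h0, h]

theorem qBinom_eq_zero_of_lt (q : ℂ) {m k : ℕ} (h : m < k) : qBinom q m k = 0 :=
  if_neg h.not_ge

theorem qBinom_self {q : ℂ} (hq : notRootOfUnity q) (m : ℕ) : qBinom q m m = 1 := by
  have h := qPoch_self_ne_zero hq m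
  have h0 : qPoch q q 0 = 1 := Finset.prod_range_zero _
  simp [qBinom, h0, h]

/-- The q-Pascal rule. -/
theorem qBinom_succ_succ {q : ℂ} (hq : notRootOfUnity q) {m k : ℕ} (hk : k ≤ m) :
    qBinom q (m + 1) (k + 1) = qBinom q m (k + 1) + q ^ (m - k) * qBinom q m k := by
  obtain ⟨d, rfl⟩ := Nat.exists_eq_add_of_le hk
  cases d with
  | zero =>
    simp [qBinom_self hq, qBinom_eq_zero_of_lt]
  | succ d =>
    have e1 : k + (d + 1) + 1 - (k + 1) = d + 1 := by omega
    have e2 : k + (d + 1) - (k + 1) = d := by omega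
    have e3 : k + (d + 1) - k = d + 1 := by omega
    rw [qBinom, qBinom, qBinom, if_pos (by omega), if_pos (by omega), if_pos (by omega),
      e1, e2, e3]
    have hk' := qPoch_self_ne_zero hq (k + 1)
    have hd' := qPoch_self_ne_zero hq (d + 1)
    rw [qPoch_succ q q (k + (d + 1))]
    rw [qPoch_succ] at hk' hd' ⊢
    rw [qPoch_succ q q d]
    obtain ⟨hk0, hk1⟩ := mul_ne_zero_iff.1 hk'
    obtain ⟨hd0, hd1⟩ := mul_ne_zero_iff.1 hd'
    field_simp
    ring

/-- The q-Chu–Vandermonde sum. -/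
theorem sum_qBinom_mul_qPoch {q : ℂ} (hq : notRootOfUnity q) (x l : ℂ) (m : ℕ) :
    ∑ k ∈ Finset.range (m + 1), qBinom q m k * x ^ k * qPoch q l k * qPoch q x (m - k)
      = qPoch q (l * x) m := by
  induction m with
  | zero => simp [qBinom_zero_right hq, qPoch]
  | succ m ih =>
    have pascal : ∀ k ∈ Finset.range (m + 1),
        qBinom q (m + 1) (k + 1) * x ^ (k + 1) * qPoch q l (k + 1)
            * qPoch q x (m + 1 - (k + 1))
          = qBinom q m (k + 1) * x ^ (k + 1) * qPoch q l (k + 1)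
              * qPoch q x (m + 1 - (k + 1))
            + q ^ (m - k) * qBinom q m k * x ^ (k + 1) * qPoch q l (k + 1)
              * qPoch q x (m - k) := by
      intro k hk
      rw [qBinom_succ_succ hq (Finset.mem_range_succ_iff.1 hk), Nat.add_sub_add_right]
      ring
    have shift := Finset.sum_range_succ'
      (fun k => qBinom q m k * x ^ k * qPoch q l k * qPoch q x (m + 1 - k)) (m + 1)
    rw [Finset.sum_range_succ, qBinom_eq_zero_of_lt q m.lt_succ_self] at shift
    rw [Finset.sum_range_succ', Finset.sum_congr rfl pascal, Finset.sum_add_distrib,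
      qBinom_zero_right hq, add_right_comm]
    rw [qBinom_zero_right hq] at shift
    rw [← shift, qPoch_succ q (l * x), ← ih, Finset.sum_mul, zero_mul, zero_mul, zero_mul, add_zero,
      ← Finset.sum_add_distrib]
    refine Finset.sum_congr rfl fun k hk => ?_
    obtain ⟨d, rfl⟩ := Nat.exists_eq_add_of_le (Finset.mem_range_succ_iff.1 hk)
    rw [add_assoc, Nat.add_sub_cancel_left, Nat.add_sub_cancel_left, qPoch_succ, qPoch_succ]
    ring

theorem phi_sub_left {k : ℕ} (a b c : Fin k → ℤ) :
    phi (fun i => a i - b i) c = phi a c - phi b c := by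
  simp only [phi, ← Finset.sum_sub_distrib]
  refine Finset.sum_congr rfl fun i _ => Finset.sum_congr rfl fun j _ => ?_
  split_ifs <;> ring

theorem phi_sub_right {k : ℕ} (a b c : Fin k → ℤ) :
    phi a (fun i => b i - c i) = phi a b - phi a c := by
  simp only [phi, ← Finset.sum_sub_distrib]
  refine Finset.sum_congr rfl fun i _ => Finset.sum_congr rfl fun j _ => ?_
  split_ifs <;> ring

theorem phi_succ {k : ℕ} (β γ : Fin (k + 1) → ℤ) :
    phi β γ = β 0 * ∑ i : Fin k, γ i.succ + phi (fun i => β i.succ) (fun i => γ i.succ) := by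
  simp [phi, Fin.sum_univ_succ, Finset.mul_sum]

theorem sum_Iic_succ {M : Type*} [AddCommMonoid M] {n : ℕ} (α : Fin (n + 1) → ℕ)
    (f : (Fin (n + 1) → ℕ) → M) :
    ∑ γ ∈ Finset.Iic α, f γ
      = ∑ γ ∈ Finset.Iic (Fin.tail α), ∑ g ∈ Finset.range (α 0 + 1), f (Fin.cons g γ) := by
  rw [← Finset.sum_product']
  refine Finset.sum_nbij' (fun γ => (Fin.tail γ, γ 0)) (fun p => Fin.cons p.2 p.1) ?_ ?_ ?_ ?_ ?_
  · intro γ hγ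
    have hγ := Finset.mem_Iic.1 hγ
    simp only [Finset.mem_product, Finset.mem_Iic, Finset.mem_range_succ_iff]
    exact ⟨fun i => hγ (Fin.succ i), hγ 0⟩
  · rintro ⟨γ, g⟩ h
    simp only [Finset.mem_product, Finset.mem_Iic, Finset.mem_range_succ_iff] at h ⊢
    exact fun i => Fin.cases h.2 h.1 i
  · intro γ _
    simp
  · rintro ⟨γ, g⟩ _
    simp
  · intro γ _
    simp

/-- The multivariable q-Chu–Vandermonde sum. -/
theorem sum_Iic_qBinom_mul_qPoch {q : ℂ} (hq0 : q ≠ 0) (hq : notRootOfUnity q) (x l : ℂ)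
    {n : ℕ} (α : Fin n → ℕ) :
    ∑ γ ∈ Finset.Iic α,
      q ^ phi (fun i => (γ i : ℤ)) (fun i => (α i : ℤ) - (γ i : ℤ))
        * x ^ (∑ i, γ i) * qPoch q l (∑ i, γ i) * qPoch q x ((∑ i, α i) - ∑ i, γ i)
        * ∏ i, qBinom q (α i) (γ i)
      = qPoch q (l * x) (∑ i, α i) := by
  induction n with
  | zero =>
    have : Finset.Iic α = {α} := by
      ext γ
      simp [Subsingleton.elim γ α]
    simp [this, phi, qPoch]
  | succ n ih =>
    rw [sum_Iic_succ, Fin.sum_univ_succ, add_comm (α 0) (∑ i : Fin n, α i.succ), qPoch_add]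
    have ih' := ih (Fin.tail α)
    simp only [Fin.tail] at ih' ⊢
    rw [← ih', Finset.sum_mul]
    refine Finset.sum_congr rfl fun γ hγ => ?_
    have hle : ∑ i, γ i ≤ ∑ i, α (Fin.succ i) :=
      Finset.sum_le_sum fun i _ => Finset.mem_Iic.1 hγ i
    obtain ⟨d, hd⟩ := Nat.exists_eq_add_of_le hle
    have hdz : ∑ i : Fin n, ((α i.succ : ℤ) - (γ i : ℤ)) = d := by
      rw [Finset.sum_sub_distrib]
      have : ((∑ i : Fin n, α i.succ : ℕ) : ℤ) = ((∑ i, γ i : ℕ) : ℤ) + d := by exact_mod_cast hd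
      push_cast at this
      omega
    have one := sum_qBinom_mul_qPoch hq (x * q ^ d) (l * q ^ (∑ i, γ i)) (α 0)
    rw [show l * x * q ^ (∑ i : Fin n, α i.succ) = l * q ^ (∑ i, γ i) * (x * q ^ d) by
      rw [hd]; ring, ← one, Finset.mul_sum]
    refine Finset.sum_congr rfl fun g hg => ?_
    obtain ⟨e, he⟩ := Nat.exists_eq_add_of_le (Finset.mem_range_succ_iff.1 hg)
    simp only [phi_succ, Fin.sum_univ_succ, Fin.prod_univ_succ, Fin.cons_zero, Fin.cons_succ, hdz]
    rw [hd, he, show (∑ i, γ i) + d + (g + e) - (g + ∑ i, γ i) = d + e by omega,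
      Nat.add_sub_cancel_left, Nat.add_sub_cancel_left, add_comm g (∑ i, γ i), qPoch_add,
      qPoch_add, zpow_add₀ hq0, ← Nat.cast_mul, zpow_natCast]
    ring

/-- The identity underlying the trivial `K`-representation of the ZF algebra:
`Σ_{γ ≤ α} q^{φ(γ,α) − φ(α,γ)} Φ_q^{(n)}(γ|α;λ,μ) = 1`. -/
theorem trivial_rep_identity (n : ℕ) (hn : 1 ≤ n) (q lam mu : ℂ) (hq0 : q ≠ 0)
    (hq : notRootOfUnity q) (hlam : lam ≠ 0)
    (α : Fin n → ℕ) (h : qPoch q mu (∑ i, α i) ≠ 0) :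
    ∑ γ ∈ Finset.Iic α,
      q ^ (phi (fun i => (γ i : ℤ)) (fun i => (α i : ℤ))
            - phi (fun i => (α i : ℤ)) (fun i => (γ i : ℤ)))
        * Phi n q lam mu γ α = 1 := by
  have hmul : lam * (mu / lam) = mu := mul_div_cancel₀ mu hlam
  have key := sum_Iic_qBinom_mul_qPoch hq0 hq (mu / lam) lam α
  rw [hmul] at key
  rw [← div_self h]
  nth_rewrite 1 [← key]
  rw [Finset.sum_div]
  refine Finset.sum_congr rfl fun γ hγ => ?_
  rw [Phi, if_pos (Finset.mem_Iic.1 hγ), mul_div_assoc', ← mul_assoc, ← mul_assoc, ← mul_assoc,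
    ← mul_assoc, ← zpow_add₀ hq0, phi_sub_left, phi_sub_right, sub_add_sub_cancel]
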